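/- Asymptotic optimality of the LSJPC filter: for all K, T > 0 there exists C > 0 such that for all N, M, L ∈ ℕ with L ≤ N+M and all symmetric positive semidefinite Σ_Z ∈ ℝ^{(N+M)×(N+M)} with spectral data as in the context, if ‖Σ_Z‖ ≤ T, the Y-block Σ_Y is positive definite with ‖Σ_Y⁻¹‖ ≤ K, and δ := ‖V_YLᵀ·V_YL − I_L‖ ≤ 1/2, then the LSJPC approximation V_XL·V_YLᵀ satisfies ‖Σ_XY·Σ_Y⁻¹ − V_XL·V_YLᵀ‖ ≤ C·(ρ_L + √δ), where ‖·‖ is the operator norm and ρ_L := Σ_{i>L} s_i. -/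

import Mathlib

open Matrix

/-- The `ℓ²`-operator norm of a real matrix. -/
noncomputable def opNorm {m n : Type*} [Fintype m] [Fintype n] [DecidableEq n]
    (A : Matrix m n ℝ) : ℝ :=
  ‖(Matrix.toEuclideanLin A).toContinuousLinearMap‖

open scoped Matrix.Norms.L2Operator in
/-- `opNorm` is Mathlib's `ℓ²`-operator norm. -/
theorem opNorm_eq_norm {m n : Type*} [Fintype m] [Fintype n] [DecidableEq n]
    (A : Matrix m n ℝ) : opNorm A = ‖A‖ := by
  rw [Matrix.l2_opNorm_def]
  rfl

open scoped Matrix.Norms.L2Operator in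
theorem norm_transpose_mul_self_eq_sq {m n : Type*} [Fintype m] [Fintype n] [DecidableEq n]
    (A : Matrix m n ℝ) : ‖Aᵀ * A‖ = ‖A‖ ^ 2 := by
  have h := Matrix.l2_opNorm_conjTranspose_mul_self A
  rwa [conjTranspose_eq_transpose_of_trivial, ← sq] at h

open scoped Matrix.Norms.L2Operator in
theorem norm_transpose_eq {m n : Type*} [Fintype m] [Fintype n] [DecidableEq n] [DecidableEq m]
    (A : Matrix m n ℝ) : ‖Aᵀ‖ = ‖A‖ := by
  rw [← conjTranspose_eq_transpose_of_trivial, Matrix.l2_opNorm_conjTranspose]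

open scoped Matrix.Norms.L2Operator in
/-- A block of a matrix with orthonormal columns is a contraction. -/
theorem norm_le_one_of_transpose_mul_self_add {m k n : Type*} [Fintype m] [Fintype k] [Fintype n]
    [DecidableEq n] (A : Matrix m n ℝ) (B : Matrix k n ℝ) (h : Aᵀ * A + Bᵀ * B = 1) :
    ‖A‖ ≤ 1 := by
  rw [Matrix.l2_opNorm_def]
  refine ContinuousLinearMap.opNorm_le_bound _ zero_le_one fun v => ?_
  rw [one_mul]
  refine le_of_sq_le_sq ?_ (norm_nonneg v)
  have key : (A *ᵥ v.ofLp) ⬝ᵥ (A *ᵥ v.ofLp) + (B *ᵥ v.ofLp) ⬝ᵥ (B *ᵥ v.ofLp)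
      = v.ofLp ⬝ᵥ v.ofLp := by
    have := congrArg (fun C : Matrix n n ℝ => v.ofLp ⬝ᵥ (C *ᵥ v.ofLp)) h
    simpa [Matrix.add_mulVec, dotProduct_add, ← Matrix.mulVec_mulVec, Matrix.dotProduct_mulVec,
      Matrix.vecMul_transpose] using this
  have hB : 0 ≤ (B *ᵥ v.ofLp) ⬝ᵥ (B *ᵥ v.ofLp) :=
    Finset.sum_nonneg fun i _ => mul_self_nonneg _
  rw [EuclideanSpace.real_norm_sq_eq, EuclideanSpace.real_norm_sq_eq]
  simp only [dotProduct, ← sq] at key hB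
  change ∑ i, (A *ᵥ v.ofLp) i ^ 2 ≤ _
  linarith

theorem sum_smul_vecMulVec_eq {m k n : Type*} [Fintype n] [DecidableEq n]
    (s : n → ℝ) (x : n → m → ℝ) (y : n → k → ℝ) :
    ∑ i, s i • Matrix.vecMulVec (x i) (y i)
      = (Matrix.of x)ᵀ * Matrix.diagonal s * Matrix.of y := by
  ext a b
  rw [Matrix.mul_apply]
  simp only [Matrix.sum_apply, Matrix.smul_apply, Matrix.vecMulVec_apply,
    Matrix.mul_diagonal, Matrix.transpose_apply, Matrix.of_apply, smul_eq_mul]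
  exact Finset.sum_congr rfl fun i _ => by ring

theorem sum_eq_sum_castLE_add {α : Type*} [AddCommMonoid α] {n L : ℕ} (hL : L ≤ n)
    (f : Fin n → α) :
    ∑ i, f i = ∑ l : Fin L, f (Fin.castLE hL l) + ∑ i : Fin n, if L ≤ (i : ℕ) then f i else 0 := by
  obtain ⟨k, rfl⟩ := Nat.exists_eq_add_of_le hL
  have h : ∀ i : Fin L, ¬ L ≤ (i : ℕ) := fun i => by omega
  rw [Fin.sum_univ_add, Fin.sum_univ_add (fun i : Fin (L + k) => if L ≤ (i : ℕ) then f i else 0)]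
  simp [h]
  rfl

open scoped Matrix.Norms.L2Operator in
/-- The coefficients of a spectral decomposition are bounded by the operator norm. -/
theorem norm_le_norm_sum_smul_vecMulVec {m n : Type*} [Fintype m] [DecidableEq m] [Fintype n]
    [DecidableEq n] (s : n → ℝ) (w : n → m → ℝ)
    (hw : ∀ i j, w i ⬝ᵥ w j = if i = j then (1 : ℝ) else 0) :
    ‖s‖ ≤ ‖∑ i, s i • Matrix.vecMulVec (w i) (w i)‖ := by
  rw [sum_smul_vecMulVec_eq]
  set W : Matrix n m ℝ := Matrix.of w with hW
  have h1 : W * Wᵀ = 1 := by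
    ext i j
    simpa [Matrix.one_apply, Matrix.mul_apply, dotProduct, hW] using hw i j
  have hn : ‖Wᵀ‖ ≤ 1 := norm_le_one_of_transpose_mul_self_add Wᵀ (0 : Matrix m n ℝ) (by simp [h1])
  have hn' : ‖W‖ ≤ 1 := by rwa [norm_transpose_eq] at hn
  have hD : Matrix.diagonal s = W * (Wᵀ * Matrix.diagonal s * W) * Wᵀ := by
    calc Matrix.diagonal s = (W * Wᵀ) * Matrix.diagonal s * (W * Wᵀ) := by simp [h1]
      _ = _ := by simp only [Matrix.mul_assoc]
  rw [← Matrix.l2_opNorm_diagonal (𝕜 := ℝ) s]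
  conv_lhs => rw [hD]
  set S := Wᵀ * Matrix.diagonal s * W
  calc ‖W * S * Wᵀ‖ ≤ ‖W * S‖ * ‖Wᵀ‖ := Matrix.l2_opNorm_mul _ _
    _ ≤ ‖W‖ * ‖S‖ * ‖Wᵀ‖ := by gcongr; exact Matrix.l2_opNorm_mul _ _
    _ ≤ 1 * ‖S‖ * 1 := by gcongr
    _ = ‖S‖ := by ring

open scoped Matrix.Norms.L2Operator in
theorem norm_transpose_mul_diagonal_mul_le {m k n : Type*} [Fintype m] [DecidableEq m] [Fintype k]
    [DecidableEq k] [Fintype n] [DecidableEq n] (A : Matrix n m ℝ) (s : n → ℝ) (B : Matrix n k ℝ) :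
    ‖Aᵀ * Matrix.diagonal s * B‖ ≤ ‖Aᵀ‖ * ‖s‖ * ‖Bᵀ‖ := by
  rw [norm_transpose_eq B, ← Matrix.l2_opNorm_diagonal (𝕜 := ℝ) s]
  exact (Matrix.l2_opNorm_mul _ _).trans
    (mul_le_mul_of_nonneg_right (Matrix.l2_opNorm_mul _ _) (norm_nonneg _))

open scoped Matrix.Norms.L2Operator in
/-- Asymptotic optimality of the LSJPC filter: for all `K, T > 0` there is `C > 0` such that
for all spectral data with `‖Σ_Z‖ ≤ T`, `Σ_Y` positive definite with `‖Σ_Y⁻¹‖ ≤ K`, and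
`δ = ‖V_YLᵀ V_YL − I_L‖ ≤ 1/2`, the LSJPC approximation `V_XL V_YLᵀ` satisfies
`‖Σ_XY Σ_Y⁻¹ − V_XL V_YLᵀ‖ ≤ C (ρ_L + √δ)` with `ρ_L = ∑_{i>L} sᵢ`. -/
theorem lsjpc_asymptotic_optimality :
    ∀ K T : ℝ, 0 < K → 0 < T →
    ∃ C : ℝ, 0 < C ∧
      ∀ (N M L : ℕ),
      ∀ (s : Fin (N + M) → ℝ), (∀ i, 0 ≤ s i) →
      (∀ i j : Fin (N + M), i ≤ j → s j ≤ s i) →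
      ∀ (x : Fin (N + M) → Fin N → ℝ) (y : Fin (N + M) → Fin M → ℝ),
      (∀ i j, x i ⬝ᵥ x j + y i ⬝ᵥ y j = if i = j then (1 : ℝ) else 0) →
      ∀ (hL : L ≤ N + M)
        (CXY : Matrix (Fin N) (Fin M) ℝ)
        (_ : CXY = ∑ i : Fin (N + M), s i • Matrix.vecMulVec (x i) (y i))
        (CY : Matrix (Fin M) (Fin M) ℝ)
        (_ : CY = ∑ i : Fin (N + M), s i • Matrix.vecMulVec (y i) (y i))
        (VXL : Matrix (Fin N) (Fin L) ℝ)
        (_ : VXL = Matrix.of fun (n : Fin N) (l : Fin L) => x (Fin.castLE hL l) n)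
        (VYL : Matrix (Fin M) (Fin L) ℝ)
        (_ : VYL = Matrix.of fun (m : Fin M) (l : Fin L) => y (Fin.castLE hL l) m),
      opNorm (∑ i : Fin (N + M),
          s i • Matrix.vecMulVec (Sum.elim (x i) (y i)) (Sum.elim (x i) (y i))) ≤ T →
      CY.PosDef →
      opNorm CY⁻¹ ≤ K →
      opNorm (VYLᵀ * VYL - 1) ≤ 1 / 2 →
      opNorm (CXY * CY⁻¹ - VXL * VYLᵀ)
        ≤ C * ((∑ i : Fin (N + M), if L ≤ (i : ℕ) then s i else 0)
            + Real.sqrt (opNorm (VYLᵀ * VYL - 1))) := by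
  intro K T hK hT
  refine ⟨K * T + K + 1, by positivity, ?_⟩
  intro N M L s hs _ x y hxy hL CXY hCXY CY _ VXL hVXL VYL hVYL hZ _ hInv _
  rw [opNorm_eq_norm] at hZ hInv
  rw [opNorm_eq_norm, opNorm_eq_norm]
  have horth : ∀ {ι : Type} [Fintype ι] [DecidableEq ι] (e : ι → Fin (N + M)),
      Function.Injective e →
      (Matrix.of (x ∘ e))ᵀᵀ * (Matrix.of (x ∘ e))ᵀ
        + (Matrix.of (y ∘ e))ᵀᵀ * (Matrix.of (y ∘ e))ᵀ = 1 := by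
    intro ι _ _ e he
    ext i j
    simpa [Matrix.one_apply, Matrix.mul_apply, dotProduct, he.eq_iff] using hxy (e i) (e j)
  have hL_orth := horth (Fin.castLE hL) (Fin.castLE_injective hL)
  have hall := horth id Function.injective_id
  have hX : VXL = (Matrix.of (x ∘ Fin.castLE hL))ᵀ := hVXL
  have hY : VYL = (Matrix.of (y ∘ Fin.castLE hL))ᵀ := hVYL
  rw [← hX, ← hY] at hL_orth
  have hsT : ‖s‖ ≤ T := by
    refine (norm_le_norm_sum_smul_vecMulVec s (fun i => Sum.elim (x i) (y i)) ?_).trans hZ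
    intro i j
    rw [← hxy i j]
    simp [dotProduct]
  have hsL : ‖s ∘ Fin.castLE hL‖ ≤ T :=
    (pi_norm_le_iff_of_nonneg hT.le).2 fun l => (norm_le_pi_norm s _).trans hsT
  have hδ : Real.sqrt ‖VYLᵀ * VYL - 1‖ = ‖VXL‖ := by
    rw [← hL_orth, sub_add_cancel_right, norm_neg, norm_transpose_mul_self_eq_sq,
      Real.sqrt_sq (norm_nonneg _)]
  have hY1 : ‖VYL‖ ≤ 1 :=
    norm_le_one_of_transpose_mul_self_add VYL VXL (by rw [add_comm]; exact hL_orth)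
  have hx1 : ‖(Matrix.of x)ᵀ‖ ≤ 1 := norm_le_one_of_transpose_mul_self_add _ _ hall
  have hy1 : ‖(Matrix.of y)ᵀ‖ ≤ 1 :=
    norm_le_one_of_transpose_mul_self_add _ _ ((add_comm _ _).trans hall)
  set ρ : ℝ := ∑ i : Fin (N + M), if L ≤ (i : ℕ) then s i else 0 with hρ
  set t : Fin (N + M) → ℝ := fun i => if L ≤ (i : ℕ) then s i else 0 with ht
  have ht0 : ∀ i, 0 ≤ t i := fun i => by
    simp only [ht]; split_ifs; exacts [hs i, le_rfl]
  have hρ0 : 0 ≤ ρ := Finset.sum_nonneg fun i _ => ht0 i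
  have htρ : ‖t‖ ≤ ρ := (pi_norm_le_iff_of_nonneg hρ0).2 fun i => by
    rw [Real.norm_of_nonneg (ht0 i)]
    exact Finset.single_le_sum (f := t) (fun j _ => ht0 j) (Finset.mem_univ i)
  have hsplit : CXY = VXL * Matrix.diagonal (s ∘ Fin.castLE hL) * (Matrix.of (y ∘ Fin.castLE hL))
      + (Matrix.of x)ᵀ * Matrix.diagonal t * Matrix.of y := by
    rw [hCXY, sum_eq_sum_castLE_add hL, hX, ← sum_smul_vecMulVec_eq, ← sum_smul_vecMulVec_eq]
    simp [ht, ite_smul]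
  have hCn : ‖CXY‖ ≤ T * ‖VXL‖ + ρ := by
    rw [hsplit]
    refine (norm_add_le _ _).trans (add_le_add ?_ ?_)
    · have h := norm_transpose_mul_diagonal_mul_le (Matrix.of (x ∘ Fin.castLE hL))
        (s ∘ Fin.castLE hL) (Matrix.of (y ∘ Fin.castLE hL))
      rw [← hX, ← hY] at h
      calc _ ≤ _ := h
        _ ≤ ‖VXL‖ * T * 1 := by gcongr
        _ = T * ‖VXL‖ := by ring
    · calc _ ≤ _ := norm_transpose_mul_diagonal_mul_le (Matrix.of x) t (Matrix.of y)
        _ ≤ 1 * ρ * 1 := by gcongr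
        _ = ρ := by ring
  rw [hδ]
  have hv := norm_nonneg VXL
  calc ‖CXY * CY⁻¹ - VXL * VYLᵀ‖ ≤ ‖CXY * CY⁻¹‖ + ‖VXL * VYLᵀ‖ := norm_sub_le _ _
    _ ≤ ‖CXY‖ * ‖CY⁻¹‖ + ‖VXL‖ * ‖VYLᵀ‖ :=
      add_le_add (Matrix.l2_opNorm_mul _ _) (Matrix.l2_opNorm_mul _ _)
    _ ≤ (T * ‖VXL‖ + ρ) * K + ‖VXL‖ * 1 := by
      rw [norm_transpose_eq]
      gcongr
    _ ≤ (K * T + K + 1) * (ρ + ‖VXL‖) := by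
      nlinarith [mul_nonneg hK.le hv, mul_nonneg (mul_nonneg hK.le hT.le) hρ0]
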